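/- Let G be an abelian group. Then there are positive constants c₁ and c₂, depending at most on G, with the following property. Suppose that N is a sufficiently large natural number, let B be a non-empty finite subset of G with |B| ≤ N, and suppose that δ and θ are real numbers with 0 < δ < 1. Then either E₊(B) ≤ N^(3−δ)·(log N)^θ, or else there exists a subset A' of B such that |A'| ≥ c₁·N^(1−3δ/4)·(log N)^((3θ−5)/4) and |A'+A'| ≤ c₂·N^(7δ)·(log N)^(5−7θ)·|A'|. -/

import Mathlib

open Finset Pointwise

/-- Additive energy `E₊(B) = #{(b₁,b₂,b₃,b₄) ∈ B⁴ : b₁+b₂ = b₃+b₄}`. -/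
def addE {G : Type*} [AddCommGroup G] [DecidableEq G] (B : Finset G) : ℕ :=
  ((B ×ˢ B ×ˢ B ×ˢ B).filter fun x => x.1 + x.2.1 = x.2.2.1 + x.2.2.2).card

/-- If every element of `S` has at least `m` preimages in `T`, then `#S * m ≤ #T`. -/
lemma card_mul_le_card_of_fibers {α β : Type*} [DecidableEq α] (S : Finset α) (T : Finset β)
    (g : β → α) (m : ℝ) (h : ∀ s ∈ S, m ≤ (#{t ∈ T | g t = s} : ℝ)) :
    (#S : ℝ) * m ≤ #T := by
  have h₁ : (#S : ℝ) * m ≤ ∑ s ∈ S, (#{t ∈ T | g t = s} : ℝ) := by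
    simpa using Finset.card_nsmul_le_sum S _ m h
  have h₂ : ∑ s ∈ S, #{t ∈ T | g t = s} ≤ #T := by
    rw [Finset.sum_card_fiberwise_eq_card_filter]
    exact Finset.card_filter_le _ _
  exact h₁.trans (by exact_mod_cast h₂)

open Classical in
/-- If few pairs of elements of `X` are bad, then at least half of the elements of `X` lie in few
bad pairs. -/
lemma card_filter_few_bad {α : Type*} (X : Finset α) (bad : α → α → Prop) (M : ℝ)
    (h : M * #{p ∈ X ×ˢ X | bad p.1 p.2} ≤ (#X : ℝ) ^ 2) :
    (#X : ℝ) / 2 ≤ #{a ∈ X | M * #{c ∈ X | bad a c} ≤ 2 * (#X : ℝ)} := by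
  rcases X.eq_empty_or_nonempty with rfl | hX
  · simp
  have hX₀ : (0 : ℝ) < #X := by exact_mod_cast hX.card_pos
  rcases le_or_gt 0 M with hM | hM
  swap
  · rw [Finset.filter_true_of_mem]
    · linarith
    · intro a _
      nlinarith [Nat.cast_nonneg (α := ℝ) (#{c ∈ X | bad a c})]
  have hsum : #{p ∈ X ×ˢ X | bad p.1 p.2} = ∑ a ∈ X, #{c ∈ X | bad a c} := by
    simp only [Finset.card_filter, Finset.sum_product]
  set p : α → Prop := fun a ↦ M * #{c ∈ X | bad a c} ≤ 2 * (#X : ℝ)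
  have hcard : (#{a ∈ X | p a} : ℝ) + #{a ∈ X | ¬ p a} = #X := by
    exact_mod_cast Finset.card_filter_add_card_filter_not (s := X) p
  have h₁ : (#{a ∈ X | ¬ p a} : ℝ) * (2 * #X) ≤ ∑ a ∈ X with ¬ p a, M * #{c ∈ X | bad a c} := by
    rw [← nsmul_eq_mul]
    refine Finset.card_nsmul_le_sum _ _ _ fun a ha ↦ ?_
    exact (not_le.1 (Finset.mem_filter.1 ha).2).le
  have h₂ : ∑ a ∈ X with ¬ p a, M * (#{c ∈ X | bad a c} : ℝ) ≤
      ∑ a ∈ X, M * (#{c ∈ X | bad a c} : ℝ) :=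
    Finset.sum_le_sum_of_subset_of_nonneg (Finset.filter_subset _ _) fun _ _ _ ↦ by positivity
  rw [hsum, Nat.cast_sum, Finset.mul_sum] at h
  have h₃ : (#{a ∈ X | ¬ p a} : ℝ) * 2 ≤ #X := by
    have := h₁.trans (h₂.trans h)
    nlinarith
  linarith

open Classical in
/-- In a family of subsets of `A` that is large in mean square, and in which no bad pair is covered
often, some member contains many elements lying in few bad pairs. -/
lemma exists_few_bad {ι α : Type*} (I : Finset ι) (hI : I.Nonempty) (A : Finset α)
    (X : ι → Finset α) (hX : ∀ i ∈ I, X i ⊆ A) (bad : α → α → Prop) (η M T : ℝ) (hM : 0 ≤ M)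
    (hT : 0 ≤ T)
    (hbad : ∀ a ∈ A, ∀ a' ∈ A, bad a a' → (#{i ∈ I | a ∈ X i ∧ a' ∈ X i} : ℝ) ≤ η) (hη : 0 ≤ η)
    (hsum : #I * T + M * η * (#A : ℝ) ^ 2 ≤ ∑ i ∈ I, (#(X i) : ℝ) ^ 2) :
    ∃ i ∈ I, T ≤ (#(X i) : ℝ) ^ 2 ∧ ∃ A' ⊆ X i, (#(X i) : ℝ) / 2 ≤ #A' ∧
      ∀ a ∈ A', M * #{c ∈ X i | bad a c} ≤ 2 * (#(X i) : ℝ) := by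
  have hswap : (∑ i ∈ I, #{p ∈ X i ×ˢ X i | bad p.1 p.2} : ℝ) ≤ η * (#A : ℝ) ^ 2 := by
    have h₁ : ∑ i ∈ I, #{p ∈ X i ×ˢ X i | bad p.1 p.2} ≤
        ∑ i ∈ I, #{p ∈ A ×ˢ A | (p.1 ∈ X i ∧ p.2 ∈ X i) ∧ bad p.1 p.2} := by
      refine Finset.sum_le_sum fun i hi ↦ Finset.card_le_card fun p hp ↦ ?_
      simp only [Finset.mem_filter, Finset.mem_product] at hp ⊢
      exact ⟨⟨hX i hi hp.1.1, hX i hi hp.1.2⟩, hp⟩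
    have h₂ : ∑ i ∈ I, #{p ∈ A ×ˢ A | (p.1 ∈ X i ∧ p.2 ∈ X i) ∧ bad p.1 p.2} =
        ∑ p ∈ A ×ˢ A, #{i ∈ I | (p.1 ∈ X i ∧ p.2 ∈ X i) ∧ bad p.1 p.2} := by
      simp only [Finset.card_filter]
      exact Finset.sum_comm
    have h₃ : ∑ p ∈ A ×ˢ A, (#{i ∈ I | (p.1 ∈ X i ∧ p.2 ∈ X i) ∧ bad p.1 p.2} : ℝ) ≤
        #(A ×ˢ A) • η := by
      refine Finset.sum_le_card_nsmul _ _ _ fun p hp ↦ ?_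
      rw [Finset.mem_product] at hp
      by_cases hb : bad p.1 p.2
      · simpa [hb] using hbad p.1 hp.1 p.2 hp.2 hb
      · simpa [hb] using hη
    rw [nsmul_eq_mul, Finset.card_product] at h₃
    have h₄ := h₁.trans h₂.le
    have h₅ : (∑ i ∈ I, #{p ∈ X i ×ˢ X i | bad p.1 p.2} : ℝ) ≤
        ∑ p ∈ A ×ˢ A, (#{i ∈ I | (p.1 ∈ X i ∧ p.2 ∈ X i) ∧ bad p.1 p.2} : ℝ) := by
      exact_mod_cast h₄
    push_cast at h₃
    linarith
  obtain ⟨i, hi, h⟩ : ∃ i ∈ I, T + M * #{p ∈ X i ×ˢ X i | bad p.1 p.2} ≤ (#(X i) : ℝ) ^ 2 := by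
    apply Finset.exists_le_of_sum_le hI
    rw [Finset.sum_add_distrib, Finset.sum_const, ← Finset.mul_sum, nsmul_eq_mul]
    nlinarith
  have hnn : 0 ≤ M * #{p ∈ X i ×ˢ X i | bad p.1 p.2} := by positivity
  exact ⟨i, hi, by linarith, _, Finset.filter_subset _ _,
    card_filter_few_bad (X i) bad M (by linarith), fun a ha ↦ (Finset.mem_filter.1 ha).2⟩

lemma sum_card_filter_comm {α β : Type*} (s : Finset α) (t : Finset β) (r : α → β → Prop)
    [∀ a b, Decidable (r a b)] :
    ∑ a ∈ s, (#{b ∈ t | r a b} : ℝ) = ∑ b ∈ t, (#{a ∈ s | r a b} : ℝ) := by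
  simp only [Finset.card_filter, Nat.cast_sum]
  exact Finset.sum_comm

/-- Balog–Szemerédi–Gowers for the graph of pairs with sum in `P`. -/
lemma exists_small_sumset_of_dense_graph {G : Type*} [AddCommGroup G] [DecidableEq G]
    (A P : Finset G) (hA : A.Nonempty) (d : ℝ) (hd : 0 < d)
    (h : d * (#A : ℝ) ^ 2 ≤ ∑ a ∈ A, (#{b ∈ A | a + b ∈ P} : ℝ)) :
    ∃ A' ⊆ A, ∃ B' ⊆ A, d / 8 * #A ≤ (#A' : ℝ) ∧ d / 4 * #A ≤ (#B' : ℝ) ∧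
      (#(A' + B') : ℝ) * (d ^ 5 * (#A : ℝ) ^ 2) ≤ 2 ^ 14 * (#P : ℝ) ^ 3 := by
  classical
  set n : ℝ := (#A : ℝ) with hn
  have hn₀ : 0 < n := Nat.cast_pos.2 hA.card_pos
  set D : Finset G := {a ∈ A | d / 2 * n ≤ (#{b ∈ A | a + b ∈ P} : ℝ)} with hD
  have hDA : D ⊆ A := Finset.filter_subset _ _
  set X : G → Finset G := fun b ↦ {a ∈ D | a + b ∈ P} with hX
  have hXsum : d / 2 * n ^ 2 ≤ ∑ b ∈ A, (#(X b) : ℝ) := by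
    refine le_of_le_of_eq ?_ (sum_card_filter_comm D A fun a b ↦ a + b ∈ P)
    rw [← Finset.sum_filter_add_sum_filter_not A
      fun a ↦ d / 2 * n ≤ (#{b ∈ A | a + b ∈ P} : ℝ)] at h
    have h₁ : ∑ a ∈ A with ¬ d / 2 * n ≤ (#{b ∈ A | a + b ∈ P} : ℝ),
        (#{b ∈ A | a + b ∈ P} : ℝ) ≤
          #{a ∈ A | ¬ d / 2 * n ≤ (#{b ∈ A | a + b ∈ P} : ℝ)} • (d / 2 * n) :=
      Finset.sum_le_card_nsmul _ _ _ fun a ha ↦ (not_le.1 (Finset.mem_filter.1 ha).2).le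
    have h₂ : (#{a ∈ A | ¬ d / 2 * n ≤ (#{b ∈ A | a + b ∈ P} : ℝ)} : ℝ) ≤ n :=
      Nat.cast_le.2 (Finset.card_filter_le _ _)
    rw [nsmul_eq_mul] at h₁
    have h₃ := mul_le_mul_of_nonneg_right h₂ (by positivity : 0 ≤ d / 2 * n)
    rw [← hD] at h
    linarith
  have hXsq : n * (d ^ 2 * n ^ 2 / 8) + 64 / d * (d ^ 3 / 512 * n) * n ^ 2 ≤
      ∑ b ∈ A, (#(X b) : ℝ) ^ 2 := by
    have h₁ : (∑ b ∈ A, (#(X b) : ℝ)) ^ 2 ≤ n * ∑ b ∈ A, (#(X b) : ℝ) ^ 2 :=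
      sq_sum_le_card_mul_sum_sq
    have h₂ : (d / 2 * n ^ 2) ^ 2 ≤ (∑ b ∈ A, (#(X b) : ℝ)) ^ 2 :=
      pow_le_pow_left₀ (by positivity) hXsum 2
    have h₃ : n * (n * (d ^ 2 * n ^ 2 / 8) + 64 / d * (d ^ 3 / 512 * n) * n ^ 2) =
        (d / 2 * n ^ 2) ^ 2 := by
      field_simp
      ring
    exact le_of_mul_le_mul_left (h₃.le.trans (h₂.trans h₁)) hn₀
  obtain ⟨v, -, hvT, A', hA'X, hA'card, hA'⟩ := exists_few_bad A hA A X
    (fun b _ ↦ (Finset.filter_subset _ _).trans hDA)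
    (fun a c ↦ (#{b ∈ A | a + b ∈ P ∧ c + b ∈ P} : ℝ) < d ^ 3 / 512 * n)
    (d ^ 3 / 512 * n) (64 / d) (d ^ 2 * n ^ 2 / 8) (by positivity) (by positivity)
    (by
      intro a _ c _ hac
      refine le_trans ?_ hac.le
      norm_cast
      refine Finset.card_le_card fun b hb ↦ ?_
      simp only [hX, Finset.mem_filter] at hb ⊢
      exact ⟨hb.1, hb.2.1.2, hb.2.2.2⟩)
    (by positivity) hXsq
  set x : ℝ := (#(X v) : ℝ) with hx
  have hxn : d / 4 * n ≤ x := by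
    refine le_of_sq_le_sq ?_ (by positivity)
    nlinarith [mul_pos hd hn₀]
  have hx₀ : 0 < x := lt_of_lt_of_le (by positivity) hxn
  have hXD : X v ⊆ D := Finset.filter_subset _ _
  refine ⟨A', hA'X.trans (hXD.trans hDA), {b ∈ A | d / 4 * x ≤ (#{c ∈ X v | c + b ∈ P} : ℝ)},
    Finset.filter_subset _ _, by linarith, ?_, ?_⟩
  · set p : G → Prop := fun b ↦ d / 4 * x ≤ (#{c ∈ X v | c + b ∈ P} : ℝ)
    have h₁ : x * (d / 2 * n) ≤ ∑ b ∈ A, (#{c ∈ X v | c + b ∈ P} : ℝ) := by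
      refine le_of_le_of_eq ?_ (sum_card_filter_comm (X v) A fun c b ↦ c + b ∈ P)
      rw [hx, ← nsmul_eq_mul]
      exact Finset.card_nsmul_le_sum _ _ _ fun c hc ↦ (Finset.mem_filter.1 (hXD hc)).2
    rw [← Finset.sum_filter_add_sum_filter_not A p] at h₁
    have h₂ : ∑ b ∈ A with p b, (#{c ∈ X v | c + b ∈ P} : ℝ) ≤ #{b ∈ A | p b} • x :=
      Finset.sum_le_card_nsmul _ _ _ fun b _ ↦ Nat.cast_le.2 (Finset.card_filter_le _ _)
    have h₃ : ∑ b ∈ A with ¬ p b, (#{c ∈ X v | c + b ∈ P} : ℝ) ≤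
        #{b ∈ A | ¬ p b} • (d / 4 * x) :=
      Finset.sum_le_card_nsmul _ _ _ fun b hb ↦ (not_le.1 (Finset.mem_filter.1 hb).2).le
    have h₄ : (#{b ∈ A | ¬ p b} : ℝ) ≤ n := Nat.cast_le.2 (Finset.card_filter_le _ _)
    rw [nsmul_eq_mul] at h₂ h₃
    have h₅ := mul_le_mul_of_nonneg_right h₄ (by positivity : 0 ≤ d / 4 * x)
    refine le_of_mul_le_mul_right ?_ hx₀
    linarith
  · set B' : Finset G := {b ∈ A | d / 4 * x ≤ (#{c ∈ X v | c + b ∈ P} : ℝ)} with hB'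
    have key := card_mul_le_card_of_fibers (A' + B') (P ×ˢ P ×ˢ P)
      (fun t ↦ t.1 - t.2.1 + t.2.2) (d / 8 * x * (d ^ 3 / 512 * n)) (by
        intro s hs
        obtain ⟨a, ha, b', hb', rfl⟩ := Finset.mem_add.1 hs
        set C : Finset G := {c ∈ X v | c + b' ∈ P ∧
          d ^ 3 / 512 * n ≤ (#{b ∈ A | a + b ∈ P ∧ c + b ∈ P} : ℝ)} with hC
        have hCcard : d / 8 * x ≤ #C := by
          have h₁ : d / 4 * x ≤ (#{c ∈ X v | c + b' ∈ P} : ℝ) := (Finset.mem_filter.1 hb').2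
          have h₂ := hA' a ha
          have h₃ : #{c ∈ X v | c + b' ∈ P} ≤ #C +
              #{c ∈ X v | (#{b ∈ A | a + b ∈ P ∧ c + b ∈ P} : ℝ) < d ^ 3 / 512 * n} := by
            refine (Finset.card_le_card fun c hc ↦ ?_).trans (Finset.card_union_le _ _)
            simp only [hC, Finset.mem_union, Finset.mem_filter] at hc ⊢
            rcases le_or_gt (d ^ 3 / 512 * n) (#{b ∈ A | a + b ∈ P ∧ c + b ∈ P} : ℝ) with h | h
            · exact Or.inl ⟨hc.1, hc.2, h⟩
            · exact Or.inr ⟨hc.1, h⟩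
          have h₄ : (#{c ∈ X v | c + b' ∈ P} : ℝ) ≤ #C +
              #{c ∈ X v | (#{b ∈ A | a + b ∈ P ∧ c + b ∈ P} : ℝ) < d ^ 3 / 512 * n} := by
            exact_mod_cast h₃
          rw [div_mul_eq_mul_div, div_le_iff₀ hd] at h₂
          nlinarith [mul_pos hd hx₀]
        have hsig : (#C : ℝ) * (d ^ 3 / 512 * n) ≤
            #(C.sigma fun c ↦ {b ∈ A | a + b ∈ P ∧ c + b ∈ P}) := by
          rw [Finset.card_sigma, ← nsmul_eq_mul, Nat.cast_sum]
          exact Finset.card_nsmul_le_sum _ _ _ fun c hc ↦ (Finset.mem_filter.1 hc).2.2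
        refine (mul_le_mul_of_nonneg_right hCcard (by positivity)).trans (hsig.trans ?_)
        norm_cast
        refine Finset.card_le_card_of_injOn
          (fun y ↦ (a + y.2, y.1 + y.2, y.1 + b')) ?_ ?_
        · rintro ⟨c, b⟩ hy
          simp only [hC, Finset.coe_sigma, Set.mem_sigma_iff, Finset.mem_coe,
            Finset.mem_filter] at hy
          simp only [Finset.mem_coe, Finset.mem_filter, Finset.mem_product]
          refine ⟨⟨hy.2.2.1, hy.2.2.2, hy.1.2.1⟩, by abel⟩
        · rintro ⟨c, b⟩ _ ⟨c', b''⟩ _ hyy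
          simp only [Prod.mk.injEq, add_right_inj, add_left_inj] at hyy
          obtain ⟨rfl, -, rfl⟩ := hyy
          rfl)
    rw [Finset.card_product, Finset.card_product] at key
    push_cast at key
    have h₁ : d / 8 * (d / 4 * n) * (d ^ 3 / 512 * n) ≤ d / 8 * x * (d ^ 3 / 512 * n) := by
      gcongr
    have h₂ := mul_le_mul_of_nonneg_left h₁ (Nat.cast_nonneg (α := ℝ) #(A' + B'))
    have h₃ : (#(A' + B') : ℝ) * (d ^ 5 * n ^ 2) =
        2 ^ 14 * (#(A' + B') * (d / 8 * (d / 4 * n) * (d ^ 3 / 512 * n))) := by ring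
    rw [h₃]
    have h₄ := h₂.trans key
    nlinarith

/-- Schoen's selection argument: if the sums with at least `α * #A` representations carry a large
part of the energy, then `A` has a large subset with small difference set. -/
lemma exists_small_diffset_of_popular {G : Type*} [AddCommGroup G] [DecidableEq G]
    (A S : Finset G) (hA : A.Nonempty) (α κ : ℝ) (hκ : 0 < κ)
    (hS : ∀ s ∈ S, α * #A ≤ (#{a ∈ A | s - a ∈ A} : ℝ))
    (h : κ / 2 * (#A : ℝ) ^ 3 ≤ ∑ s ∈ S, (#{a ∈ A | s - a ∈ A} : ℝ) ^ 2) :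
    ∃ A' ⊆ A, α / 2 * #A ≤ (#A' : ℝ) ∧ (#(A' - A') : ℝ) * (α * κ ^ 2) ≤ 2 ^ 9 * #A := by
  classical
  set n : ℝ := (#A : ℝ) with hn
  have hn₀ : 0 < n := Nat.cast_pos.2 hA.card_pos
  have hSne : S.Nonempty := by
    rw [Finset.nonempty_iff_ne_empty]
    rintro rfl
    rw [Finset.sum_empty] at h
    have : 0 < κ / 2 * n ^ 3 := by positivity
    linarith
  obtain ⟨s, hs, -, A', hA'X, hA'card, hA'⟩ := exists_few_bad S hSne A
    (fun s ↦ {a ∈ A | s - a ∈ A}) (fun s _ ↦ Finset.filter_subset _ _)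
    (fun a c ↦ (#{p ∈ A ×ˢ A | p.1 - p.2 = a - c} : ℝ) < κ / 16 * n)
    (κ / 16 * n) 8 0 (by norm_num) le_rfl
    (by
      intro a _ c _ hac
      refine le_trans ?_ hac.le
      norm_cast
      refine Finset.card_le_card_of_injOn (fun s ↦ (s - c, s - a)) ?_ ?_
      · intro s hs
        simp only [Finset.mem_coe, Finset.mem_filter, Finset.mem_product] at hs ⊢
        exact ⟨⟨hs.2.2.2, hs.2.1.2⟩, by abel⟩
      · intro s _ s' _ hss
        simpa using hss)
    (by positivity) (by
      refine le_trans (le_of_eq ?_) h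
      ring)
  set X : Finset G := {a ∈ A | s - a ∈ A} with hX
  set x : ℝ := (#X : ℝ) with hx
  have hxn : α * n ≤ x := hS s hs
  refine ⟨A', hA'X.trans (Finset.filter_subset _ _), by linarith, ?_⟩
  have key := card_mul_le_card_of_fibers (A' - A') ((A ×ˢ A) ×ˢ (A ×ˢ A))
    (fun t ↦ (t.1.1 - t.1.2) - (t.2.1 - t.2.2)) (x / 2 * ((κ / 16 * n) * (κ / 16 * n))) (by
      intro y hy
      obtain ⟨a, ha, a', ha', rfl⟩ := Finset.mem_sub.1 hy
      set R : G → Finset (G × G) := fun z ↦ {p ∈ A ×ˢ A | p.1 - p.2 = z} with hR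
      set C : Finset G := {c ∈ X | κ / 16 * n ≤ (#(R (a - c)) : ℝ) ∧
        κ / 16 * n ≤ (#(R (a' - c)) : ℝ)} with hC
      have hCcard : x / 2 ≤ #C := by
        have h₁ : 8 * (#{c ∈ X | (#(R (a - c)) : ℝ) < κ / 16 * n} : ℝ) ≤ 2 * x := hA' a ha
        have h₂ : 8 * (#{c ∈ X | (#(R (a' - c)) : ℝ) < κ / 16 * n} : ℝ) ≤ 2 * x := hA' a' ha'
        have h₃ : #X ≤ #C + #{c ∈ X | (#(R (a - c)) : ℝ) < κ / 16 * n} +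
            #{c ∈ X | (#(R (a' - c)) : ℝ) < κ / 16 * n} := by
          refine (Finset.card_le_card fun c hc ↦ ?_).trans ((Finset.card_union_le _ _).trans
            (Nat.add_le_add_right (Finset.card_union_le _ _) _))
          simp only [hC, Finset.mem_union, Finset.mem_filter]
          rcases le_or_gt (κ / 16 * n) (#(R (a - c)) : ℝ) with h | h
          · rcases le_or_gt (κ / 16 * n) (#(R (a' - c)) : ℝ) with h' | h'
            · exact Or.inl (Or.inl ⟨hc, h, h'⟩)
            · exact Or.inr ⟨hc, h'⟩
          · exact Or.inl (Or.inr ⟨hc, h⟩)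
        have h₄ : x ≤ #C + #{c ∈ X | (#(R (a - c)) : ℝ) < κ / 16 * n} +
            #{c ∈ X | (#(R (a' - c)) : ℝ) < κ / 16 * n} := by
          rw [hx]
          exact_mod_cast h₃
        linarith
      have hsig : (#C : ℝ) * ((κ / 16 * n) * (κ / 16 * n)) ≤
          #(C.sigma fun c ↦ R (a - c) ×ˢ R (a' - c)) := by
        rw [Finset.card_sigma, ← nsmul_eq_mul, Nat.cast_sum]
        refine Finset.card_nsmul_le_sum _ _ _ fun c hc ↦ ?_
        rw [Finset.card_product, Nat.cast_mul]
        have := (Finset.mem_filter.1 hc).2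
        exact mul_le_mul this.1 this.2 (by positivity) (by positivity)
      refine (mul_le_mul_of_nonneg_right hCcard (by positivity)).trans (hsig.trans ?_)
      norm_cast
      refine Finset.card_le_card_of_injOn (fun y ↦ y.2) ?_ ?_
      · rintro ⟨c, p, q⟩ hy
        simp only [hR, Finset.coe_sigma, Set.mem_sigma_iff, Finset.mem_coe, Finset.mem_filter,
          Finset.mem_product] at hy
        simp only [Finset.mem_coe, Finset.mem_filter, Finset.mem_product]
        refine ⟨⟨hy.2.1.1, hy.2.2.1⟩, ?_⟩
        rw [hy.2.1.2, hy.2.2.2]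
        abel
      · rintro ⟨c, p, q⟩ hy ⟨c', p', q'⟩ hy' hyy
        simp only [hR, Finset.coe_sigma, Set.mem_sigma_iff, Finset.mem_coe, Finset.mem_filter,
          Finset.mem_product] at hy hy'
        simp only [Prod.mk.injEq] at hyy
        obtain ⟨rfl, rfl⟩ := hyy
        have hc : a - c = a - c' := hy.2.1.2.symm.trans hy'.2.1.2
        rw [sub_right_inj] at hc
        subst hc
        rfl)
  simp only [Finset.card_product] at key
  push_cast at key
  have h₁ : α * n / 2 * ((κ / 16 * n) * (κ / 16 * n)) ≤
      x / 2 * ((κ / 16 * n) * (κ / 16 * n)) := by gcongr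
  have h₂ := (mul_le_mul_of_nonneg_left h₁ (Nat.cast_nonneg (α := ℝ) #(A' - A'))).trans key
  refine le_of_mul_le_mul_right ?_ (by positivity : 0 < n ^ 3)
  have h₃ : (#(A' - A') : ℝ) * (α * κ ^ 2) * n ^ 3 =
      2 ^ 9 * (#(A' - A') * (α * n / 2 * ((κ / 16 * n) * (κ / 16 * n)))) := by ring
  rw [h₃]
  linarith

lemma sum_card_representations_eq {G : Type*} [AddCommGroup G] [DecidableEq G]
    (A P : Finset G) :
    ∑ s ∈ P, (#{a ∈ A | s - a ∈ A} : ℝ) = ∑ a ∈ A, (#{b ∈ A | a + b ∈ P} : ℝ) := by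
  rw [sum_card_filter_comm P A fun s a ↦ s - a ∈ A]
  refine Finset.sum_congr rfl fun a _ ↦ ?_
  norm_cast
  refine Finset.card_bij' (fun s _ ↦ s - a) (fun b _ ↦ a + b) ?_ ?_ ?_ ?_ <;> simp +contextual

lemma sum_card_representations_le {G : Type*} [AddCommGroup G] [DecidableEq G]
    (A P : Finset G) :
    ∑ s ∈ P, (#{a ∈ A | s - a ∈ A} : ℝ) ≤ (#A : ℝ) ^ 2 := by
  rw [sum_card_representations_eq, sq, ← nsmul_eq_mul]
  exact Finset.sum_le_card_nsmul _ _ _ fun a _ ↦ Nat.cast_le.2 (Finset.card_filter_le _ _)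

lemma addE_le_sum_sq {G : Type*} [AddCommGroup G] [DecidableEq G] (A : Finset G) :
    (addE A : ℝ) ≤ ∑ s ∈ A + A, (#{a ∈ A | s - a ∈ A} : ℝ) ^ 2 := by
  have h := Finset.card_eq_sum_card_fiberwise (t := A + A)
    (f := fun x : G × G × G × G ↦ x.1 + x.2.1)
    (s := (A ×ˢ A ×ˢ A ×ˢ A).filter fun x ↦ x.1 + x.2.1 = x.2.2.1 + x.2.2.2) (by
      intro x hx
      simp only [Finset.mem_coe, Finset.mem_filter, Finset.mem_product] at hx
      exact Finset.add_mem_add hx.1.1 hx.1.2.1)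
  rw [addE, h]
  push_cast
  refine Finset.sum_le_sum fun s _ ↦ ?_
  rw [sq]
  norm_cast
  rw [← Finset.card_product]
  refine Finset.card_le_card_of_injOn (fun x ↦ (x.1, x.2.2.1)) ?_ ?_
  · rintro ⟨a, b, c, e⟩ hx
    simp only [Finset.mem_coe, Finset.mem_filter, Finset.mem_product] at hx ⊢
    obtain ⟨⟨⟨ha, hb, hc, he⟩, h₁⟩, rfl⟩ := hx
    refine ⟨⟨ha, by simpa using hb⟩, hc, ?_⟩
    rw [h₁]
    simpa using he
  · rintro ⟨a, b, c, e⟩ hx ⟨a', b', c', e'⟩ hx' hxx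
    simp only [Finset.mem_coe, Finset.mem_filter, Finset.mem_product] at hx hx'
    simp only [Prod.mk.injEq] at hxx
    obtain ⟨rfl, rfl⟩ := hxx
    obtain rfl : b = b' := add_left_cancel (hx.2.trans hx'.2.symm)
    obtain rfl : e = e' := add_left_cancel (hx.1.2.symm.trans hx'.1.2)
    rfl

lemma card_add_self_mul_le {G : Type*} [AddCommGroup G] [DecidableEq G] (A B : Finset G)
    (hB : B.Nonempty) : (#(A + A) : ℝ) * #B ≤ (#(A + B) : ℝ) ^ 2 := by
  have h := Finset.pluennecke_ruzsa_inequality_nsmul_add hB A 2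
  have h' : (#(2 • A) : ℝ) ≤ ((#(B + A) : ℝ) / #B) ^ 2 * #B := by
    simpa using (NNRat.cast_le (K := ℝ)).2 h
  have hB₀ : (0 : ℝ) < #B := Nat.cast_pos.2 hB.card_pos
  rw [two_nsmul, add_comm B A] at h'
  calc (#(A + A) : ℝ) * #B ≤ ((#(A + B) : ℝ) / #B) ^ 2 * #B * #B := by gcongr
    _ = _ := by field_simp

lemma card_add_self_mul_le_sub {G : Type*} [AddCommGroup G] [DecidableEq G] (A : Finset G)
    (hA : A.Nonempty) : (#(A + A) : ℝ) * #A ≤ (#(A - A) : ℝ) ^ 2 := by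
  have h := Finset.pluennecke_ruzsa_inequality_nsmul_sub hA A 2
  have h' : (#(2 • A) : ℝ) ≤ ((#(A - A) : ℝ) / #A) ^ 2 * #A := by
    simpa using (NNRat.cast_le (K := ℝ)).2 h
  have hA₀ : (0 : ℝ) < #A := Nat.cast_pos.2 hA.card_pos
  rw [two_nsmul] at h'
  calc (#(A + A) : ℝ) * #A ≤ ((#(A - A) : ℝ) / #A) ^ 2 * #A * #A := by gcongr
    _ = _ := by field_simp

/-- Balog–Szemerédi–Gowers when the energy is carried by sums whose number of representations lies
between `ρ * #A` and `τ * #A`. -/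
lemma exists_small_doubling_of_level {G : Type*} [AddCommGroup G] [DecidableEq G]
    (A P : Finset G) (hA : A.Nonempty) (ρ τ κ : ℝ) (hρ : 0 < ρ) (hτ : 0 < τ) (hκ : 0 < κ)
    (hPρ : ∀ s ∈ P, ρ * #A ≤ (#{a ∈ A | s - a ∈ A} : ℝ))
    (hPτ : ∀ s ∈ P, (#{a ∈ A | s - a ∈ A} : ℝ) ≤ τ * #A)
    (h : κ * (#A : ℝ) ^ 3 ≤ ∑ s ∈ P, (#{a ∈ A | s - a ∈ A} : ℝ) ^ 2) :
    ∃ A' ⊆ A, κ / (8 * τ) * #A ≤ (#A' : ℝ) ∧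
      (#(A' + A') : ℝ) ≤ 2 ^ 33 * (τ / (κ * ρ)) ^ 6 * #A' := by
  set n : ℝ := (#A : ℝ) with hn
  have hn₀ : 0 < n := Nat.cast_pos.2 hA.card_pos
  obtain ⟨W, hW⟩ : ∃ W : ℝ, W = ∑ s ∈ P, (#{a ∈ A | s - a ∈ A} : ℝ) := ⟨_, rfl⟩
  have hκW : κ * n ^ 2 ≤ τ * W := by
    have h₁ : ∑ s ∈ P, (#{a ∈ A | s - a ∈ A} : ℝ) ^ 2 ≤ τ * n * W := by
      rw [hW, Finset.mul_sum]
      refine Finset.sum_le_sum fun s hs ↦ ?_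
      rw [sq]
      exact mul_le_mul_of_nonneg_right (hPτ s hs) (Nat.cast_nonneg _)
    refine le_of_mul_le_mul_right ?_ hn₀
    linarith
  have hPW : #P * (ρ * n) ≤ W := by
    rw [← nsmul_eq_mul, hW]
    exact Finset.card_nsmul_le_sum _ _ _ hPρ
  have hW₀ : 0 < W := pos_of_mul_pos_right (lt_of_lt_of_le (by positivity) hκW) hτ.le
  obtain ⟨d, hWd⟩ : ∃ d, W = d * n ^ 2 := ⟨W / n ^ 2, by field_simp⟩
  have hd₀ : 0 < d := pos_of_mul_pos_left (hWd ▸ hW₀) (by positivity)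
  have hκd : κ / τ ≤ d := by
    rw [div_le_iff₀ hτ]
    refine le_of_mul_le_mul_right ?_ (by positivity : 0 < n ^ 2)
    rw [hWd] at hκW
    linarith
  have hPd : #P ≤ d * n / ρ := by
    rw [le_div_iff₀ hρ]
    refine le_of_mul_le_mul_right ?_ hn₀
    rw [hWd] at hPW
    linarith
  obtain ⟨A', hA'A, B', -, hA', hB', hsum⟩ :=
    exists_small_sumset_of_dense_graph A P hA d hd₀ (by
      rw [← sum_card_representations_eq, ← hWd, hW])
  have hA'₀ : (0 : ℝ) < #A' := lt_of_lt_of_le (by positivity) hA'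
  have hB'₀ : (0 : ℝ) < #B' := lt_of_lt_of_le (by positivity) hB'
  refine ⟨A', hA'A, le_trans ?_ hA', ?_⟩
  · have : κ / (8 * τ) = κ / τ / 8 := by ring
    rw [this]
    gcongr
  · have hpl := card_add_self_mul_le A' B' (Finset.card_pos.1 (Nat.cast_pos.1 hB'₀))
    have h₁ : (#(A' + B') : ℝ) ≤ 2 ^ 14 * n / (d ^ 2 * ρ ^ 3) := by
      rw [le_div_iff₀ (by positivity)]
      refine le_of_mul_le_mul_right ?_ (by positivity : 0 < d ^ 3 * n ^ 2)
      have h₂ : (#P : ℝ) ^ 3 ≤ (d * n / ρ) ^ 3 := by gcongr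
      have h₃ : (d * n / ρ) ^ 3 * ρ ^ 3 = d ^ 3 * n ^ 3 := by field_simp
      calc (#(A' + B') : ℝ) * (d ^ 2 * ρ ^ 3) * (d ^ 3 * n ^ 2)
          = #(A' + B') * (d ^ 5 * n ^ 2) * ρ ^ 3 := by ring
        _ ≤ 2 ^ 14 * (d * n / ρ) ^ 3 * ρ ^ 3 := by
          refine mul_le_mul_of_nonneg_right (hsum.trans ?_) (by positivity)
          gcongr
        _ = 2 ^ 14 * n * (d ^ 3 * n ^ 2) := by rw [mul_assoc, h₃]; ring
    have h₄ : τ / (κ * ρ) = 1 / (κ / τ * ρ) := by field_simp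
    have h₅ : 1 / (d * ρ) ≤ τ / (κ * ρ) := by
      rw [h₄]
      gcongr
    have h₆ : 2 ^ 33 * (1 / (d * ρ)) ^ 6 * (d / 8 * n) * (d / 4 * n) =
        (2 ^ 14 * n / (d ^ 2 * ρ ^ 3)) ^ 2 := by
      field_simp
      norm_num
    refine le_of_mul_le_mul_right ?_ hB'₀
    calc (#(A' + A') : ℝ) * #B' ≤ (#(A' + B') : ℝ) ^ 2 := hpl
      _ ≤ (2 ^ 14 * n / (d ^ 2 * ρ ^ 3)) ^ 2 := by gcongr
      _ = 2 ^ 33 * (1 / (d * ρ)) ^ 6 * (d / 8 * n) * (d / 4 * n) := h₆.symm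
      _ ≤ 2 ^ 33 * (τ / (κ * ρ)) ^ 6 * #A' * #B' := by gcongr

/-- The Balog–Szemerédi–Gowers theorem, for energy equal to `u ^ 8 * #A ^ 3`. -/
lemma exists_small_doubling_of_energy {G : Type*} [AddCommGroup G] [DecidableEq G]
    (A : Finset G) (hA : A.Nonempty) (u : ℝ) (hu : 0 < u)
    (h : u ^ 8 * (#A : ℝ) ^ 3 = addE A) :
    ∃ A' ⊆ A, u ^ 6 / 64 * #A ≤ (#A' : ℝ) ∧ (#(A' + A') : ℝ) * u ^ 56 ≤ 2 ^ 63 * #A' := by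
  set n : ℝ := (#A : ℝ) with hn
  have hn₀ : 0 < n := Nat.cast_pos.2 hA.card_pos
  set r : G → ℝ := fun s ↦ (#{a ∈ A | s - a ∈ A} : ℝ) with hr
  have hr₀ : ∀ s, 0 ≤ r s := fun s ↦ Nat.cast_nonneg _
  have hrn : ∀ s, r s ≤ n := fun s ↦ Nat.cast_le.2 (Finset.card_filter_le _ _)
  have hE : u ^ 8 * n ^ 3 ≤ ∑ s ∈ A + A, r s ^ 2 := h.le.trans (addE_le_sum_sq A)
  have hsmall : ∀ (P : Finset G) (τ : ℝ), 0 ≤ τ → (∀ s ∈ P, r s ≤ τ * n) →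
      ∑ s ∈ P, r s ^ 2 ≤ τ * n ^ 3 := by
    intro P τ hτ hP
    calc ∑ s ∈ P, r s ^ 2 ≤ ∑ s ∈ P, τ * n * r s := by
          refine Finset.sum_le_sum fun s hs ↦ ?_
          rw [sq]
          exact mul_le_mul_of_nonneg_right (hP s hs) (hr₀ s)
      _ = τ * n * ∑ s ∈ P, r s := by rw [Finset.mul_sum]
      _ ≤ τ * n * n ^ 2 := by
          gcongr
          exact sum_card_representations_le A P
      _ = τ * n ^ 3 := by ring
  have hu1 : u ≤ 1 := by
    have h₁ := hE.trans (hsmall (A + A) 1 zero_le_one fun s _ ↦ by simpa using hrn s)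
    have h₂ : u ^ 8 ≤ 1 := le_of_mul_le_mul_right h₁ (by positivity)
    exact (pow_le_one_iff_of_nonneg hu.le (by norm_num)).1 h₂
  set S₃ := {s ∈ A + A | u ^ 6 * n ≤ r s}
  set T₃ := {s ∈ A + A | ¬ u ^ 6 * n ≤ r s}
  set S₂ := {s ∈ T₃ | u ^ 7 * n ≤ r s}
  set T₂ := {s ∈ T₃ | ¬ u ^ 7 * n ≤ r s}
  set S₁ := {s ∈ T₂ | u ^ 8 / 4 * n ≤ r s}
  set T₁ := {s ∈ T₂ | ¬ u ^ 8 / 4 * n ≤ r s}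
  have h₃ : ∑ s ∈ S₃, r s ^ 2 + ∑ s ∈ T₃, r s ^ 2 = ∑ s ∈ A + A, r s ^ 2 :=
    Finset.sum_filter_add_sum_filter_not _ _ _
  have h₂ : ∑ s ∈ S₂, r s ^ 2 + ∑ s ∈ T₂, r s ^ 2 = ∑ s ∈ T₃, r s ^ 2 :=
    Finset.sum_filter_add_sum_filter_not _ _ _
  have h₁ : ∑ s ∈ S₁, r s ^ 2 + ∑ s ∈ T₁, r s ^ 2 = ∑ s ∈ T₂, r s ^ 2 :=
    Finset.sum_filter_add_sum_filter_not _ _ _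
  have h₀ : ∑ s ∈ T₁, r s ^ 2 ≤ u ^ 8 / 4 * n ^ 3 :=
    hsmall T₁ _ (by positivity) fun s hs ↦ (not_le.1 (Finset.mem_filter.1 hs).2).le
  have hlevel : ∀ (P : Finset G) (ρ τ : ℝ), 0 < ρ → 0 < τ → (∀ s ∈ P, ρ * n ≤ r s) →
      (∀ s ∈ P, r s ≤ τ * n) → u ^ 8 / 8 * n ^ 3 ≤ ∑ s ∈ P, r s ^ 2 → τ ≤ u ^ 2 →
      τ ≤ 4 * (ρ / u) →
      ∃ A' ⊆ A, u ^ 6 / 64 * n ≤ (#A' : ℝ) ∧ (#(A' + A') : ℝ) * u ^ 56 ≤ 2 ^ 63 * #A' := by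
    intro P ρ τ hρ hτ hPρ hPτ hP hτu hτρ
    obtain ⟨A', hA'A, hA', hsum⟩ := exists_small_doubling_of_level A P hA ρ τ (u ^ 8 / 8)
      hρ hτ (by positivity) hPρ hPτ hP
    refine ⟨A', hA'A, le_trans ?_ hA', ?_⟩
    · refine mul_le_mul_of_nonneg_right ?_ hn₀.le
      rw [le_div_iff₀ (by positivity)]
      nlinarith [pow_pos hu 6]
    · have hle : τ / (u ^ 8 / 8 * ρ) ≤ 32 / u ^ 9 := by
        rw [div_le_div_iff₀ (by positivity) (by positivity)]
        have h₄ : 4 * (ρ / u) * u ^ 9 = 32 * (u ^ 8 / 8 * ρ) := by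
          field_simp
          norm_num
        rw [← h₄]
        gcongr
      calc (#(A' + A') : ℝ) * u ^ 56
          ≤ 2 ^ 33 * (τ / (u ^ 8 / 8 * ρ)) ^ 6 * #A' * u ^ 56 := by gcongr
        _ ≤ 2 ^ 33 * (32 / u ^ 9) ^ 6 * #A' * u ^ 56 := by gcongr
        _ = 2 ^ 63 * #A' * u ^ 2 := by
          field_simp
          norm_num
        _ ≤ 2 ^ 63 * #A' * 1 := by
          gcongr
          exact pow_le_one₀ hu.le hu1
        _ = 2 ^ 63 * #A' := mul_one _
  have hpow : ∀ {i j : ℕ}, j ≤ i → u ^ i ≤ u ^ j := fun hij ↦ pow_le_pow_of_le_one hu.le hu1 hij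
  rcases le_or_gt (u ^ 8 / 2 * n ^ 3) (∑ s ∈ S₃, r s ^ 2) with hS₃ | hS₃
  · obtain ⟨A', hA'A, hA', hdiff⟩ := exists_small_diffset_of_popular A S₃ hA (u ^ 6) (u ^ 8)
      (by positivity) (fun s hs ↦ (Finset.mem_filter.1 hs).2) hS₃
    have hA'₀ : (0 : ℝ) < #A' := lt_of_lt_of_le (by positivity) hA'
    refine ⟨A', hA'A, le_trans ?_ hA', ?_⟩
    · gcongr
      norm_num
    · have hpl := card_add_self_mul_le_sub A' (Finset.card_pos.1 (Nat.cast_pos.1 hA'₀))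
      have h₄ : (#(A' - A') : ℝ) * u ^ 28 ≤ 2 ^ 10 * #A' := by
        have h₅ : (#(A' - A') : ℝ) * u ^ 28 = #(A' - A') * (u ^ 6 * (u ^ 8) ^ 2) * u ^ 6 := by
          ring
        rw [h₅]
        calc (#(A' - A') : ℝ) * (u ^ 6 * (u ^ 8) ^ 2) * u ^ 6 ≤ 2 ^ 9 * n * u ^ 6 := by gcongr
          _ = 2 ^ 10 * (u ^ 6 / 2 * n) := by ring
          _ ≤ _ := by gcongr
      refine le_of_mul_le_mul_right ?_ hA'₀
      calc (#(A' + A') : ℝ) * u ^ 56 * #A' = #(A' + A') * #A' * u ^ 56 := by ring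
        _ ≤ (#(A' - A') : ℝ) ^ 2 * u ^ 56 := by gcongr
        _ = (#(A' - A') * u ^ 28) ^ 2 := by ring
        _ ≤ (2 ^ 10 * #A') ^ 2 := by gcongr
        _ = 2 ^ 20 * #A' * #A' := by ring
        _ ≤ 2 ^ 63 * #A' * #A' := by
          gcongr <;> norm_num
  · rcases le_or_gt (u ^ 8 / 8 * n ^ 3) (∑ s ∈ S₂, r s ^ 2) with hS₂ | hS₂
    · refine hlevel S₂ (u ^ 7) (u ^ 6) (by positivity) (by positivity)
        (fun s hs ↦ (Finset.mem_filter.1 hs).2)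
        (fun s hs ↦ (not_le.1 (Finset.mem_filter.1 (Finset.mem_filter.1 hs).1).2).le) hS₂
        (hpow (by norm_num)) ?_
      have h₄ : u ^ 7 / u = u ^ 6 := by field_simp
      rw [h₄]
      linarith [pow_pos hu 6]
    · refine hlevel S₁ (u ^ 8 / 4) (u ^ 7) (by positivity) (by positivity)
        (fun s hs ↦ (Finset.mem_filter.1 hs).2)
        (fun s hs ↦ (not_le.1 (Finset.mem_filter.1 (Finset.mem_filter.1 hs).1).2).le)
        (by linarith) (hpow (by norm_num)) (le_of_eq ?_)
      field_simp

/-- Lemma 3.3: a Balog–Szemerédi–Gowers-type lemma. -/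
theorem bsg_variant (G : Type*) [AddCommGroup G] [DecidableEq G] :
    ∃ c₁ c₂ : ℝ, 0 < c₁ ∧ 0 < c₂ ∧ ∃ N₀ : ℕ, ∀ N : ℕ, N₀ ≤ N →
      ∀ B : Finset G, B.Nonempty → B.card ≤ N →
        ∀ δ θ : ℝ, 0 < δ → δ < 1 →
          (addE B : ℝ) ≤ (N : ℝ) ^ ((3 : ℝ) - δ) * Real.log N ^ θ ∨
          ∃ A' : Finset G, A' ⊆ B ∧
            c₁ * (N : ℝ) ^ ((1 : ℝ) - 3 * δ / 4) *
              Real.log N ^ ((3 * θ - 5) / 4) ≤ (A'.card : ℝ) ∧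
            ((A' + A').card : ℝ) ≤
              c₂ * (N : ℝ) ^ (7 * δ) * Real.log N ^ (5 - 7 * θ) * (A'.card : ℝ) := by
  refine ⟨1 / 64, 2 ^ 63, by norm_num, by norm_num, 3, fun N hN B hB hBN δ θ _ _ ↦ ?_⟩
  refine or_iff_not_imp_left.2 fun hE ↦ ?_
  rw [not_le] at hE
  have hN₀ : (0 : ℝ) < N := by positivity
  have hL : 1 ≤ Real.log N := by
    rw [Real.le_log_iff_exp_le hN₀]
    have : (3 : ℝ) ≤ N := by exact_mod_cast hN
    linarith [Real.exp_one_lt_d9]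
  set L := Real.log N
  have hL₀ : 0 < L := by linarith
  set n : ℝ := (#B : ℝ) with hn
  have hn₀ : 0 < n := Nat.cast_pos.2 hB.card_pos
  have hnN : n ≤ N := Nat.cast_le.2 hBN
  -- `v ^ 8` is the energy threshold divided by `N ^ 3`
  set v : ℝ := (N : ℝ) ^ (-δ / 8) * L ^ (θ / 8) with hv
  have hv₀ : 0 < v := by positivity
  have hvpow : ∀ k : ℕ, v ^ k = (N : ℝ) ^ (-δ / 8 * k) * L ^ (θ / 8 * k) := fun k ↦ by
    rw [hv, mul_pow, ← Real.rpow_mul_natCast hN₀.le, ← Real.rpow_mul_natCast hL₀.le]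
  have hE₀ : (0 : ℝ) < addE B := lt_of_le_of_lt (by positivity) hE
  set u : ℝ := ((addE B : ℝ) / n ^ 3) ^ (1 / 8 : ℝ) with hu
  have hu₀ : 0 < u := by positivity
  have hu8 : u ^ 8 * n ^ 3 = addE B := by
    rw [hu, ← Real.rpow_mul_natCast (by positivity)]
    norm_num
    field_simp
  have hv8 : v ^ 8 * (N : ℝ) ^ 3 ≤ u ^ 8 * n ^ 3 := by
    rw [hu8]
    refine le_trans (le_of_eq ?_) hE.le
    rw [hvpow, sub_eq_add_neg, Real.rpow_add hN₀, ← Real.rpow_natCast (N : ℝ) 3]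
    push_cast
    rw [div_mul_cancel₀ _ (by norm_num), div_mul_cancel₀ _ (by norm_num)]
    ring
  have hvu : v ≤ u := by
    refine le_of_pow_le_pow_left₀ (n := 8) (by norm_num) hu₀.le ?_
    refine le_of_mul_le_mul_right (hv8.trans ?_) (by positivity : (0 : ℝ) < (N : ℝ) ^ 3)
    gcongr
  have hsize : v ^ 6 * N ≤ u ^ 6 * n := by
    refine le_of_pow_le_pow_left₀ (n := 4) (by norm_num) (by positivity) ?_
    refine le_of_mul_le_mul_right ?_ (by positivity : 0 < n ^ 5)
    calc (v ^ 6 * N) ^ 4 * n ^ 5 ≤ (v ^ 6 * N) ^ 4 * (N : ℝ) ^ 5 := by gcongr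
      _ = (v ^ 8 * (N : ℝ) ^ 3) ^ 3 := by ring
      _ ≤ (u ^ 8 * n ^ 3) ^ 3 := by gcongr
      _ = (u ^ 6 * n) ^ 4 * n ^ 5 := by ring
  obtain ⟨A', hA'B, hA', hsum⟩ := exists_small_doubling_of_energy B hB u hu₀ hu8
  refine ⟨A', hA'B, ?_, ?_⟩
  · have h₁ : (N : ℝ) ^ (1 - 3 * δ / 4) * L ^ ((3 * θ - 5) / 4) ≤ v ^ 6 * N := by
      have h₂ : v ^ 6 * N = (N : ℝ) ^ (1 - 3 * δ / 4) * L ^ (3 * θ / 4) := by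
        have h₃ : (1 : ℝ) - 3 * δ / 4 = -δ / 8 * (6 : ℕ) + 1 := by push_cast; ring
        have h₄ : 3 * θ / 4 = θ / 8 * (6 : ℕ) := by push_cast; ring
        rw [hvpow, h₃, h₄, Real.rpow_add hN₀, Real.rpow_one]
        ring
      rw [h₂]
      gcongr
      linarith
    calc 1 / 64 * (N : ℝ) ^ (1 - 3 * δ / 4) * L ^ ((3 * θ - 5) / 4)
        = ((N : ℝ) ^ (1 - 3 * δ / 4) * L ^ ((3 * θ - 5) / 4)) / 64 := by ring
      _ ≤ (u ^ 6 * n) / 64 := by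
        exact div_le_div_of_nonneg_right (h₁.trans hsize) (by norm_num)
      _ = u ^ 6 / 64 * n := by ring
      _ ≤ #A' := hA'
  · have h₁ : 1 ≤ (N : ℝ) ^ (7 * δ) * L ^ (5 - 7 * θ) * v ^ 56 := by
      have h₂ : (N : ℝ) ^ (7 * δ) * L ^ (5 - 7 * θ) * v ^ 56 = L ^ (5 : ℝ) := by
        rw [hvpow, mul_mul_mul_comm, ← Real.rpow_add hN₀, ← Real.rpow_add hL₀]
        have h₃ : 7 * δ + -δ / 8 * (56 : ℕ) = 0 := by push_cast; ring
        have h₄ : 5 - 7 * θ + θ / 8 * (56 : ℕ) = 5 := by push_cast; ring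
        rw [h₃, h₄, Real.rpow_zero, one_mul]
      rw [h₂]
      exact Real.one_le_rpow hL (by norm_num)
    calc (#(A' + A') : ℝ)
        ≤ #(A' + A') * ((N : ℝ) ^ (7 * δ) * L ^ (5 - 7 * θ) * v ^ 56) :=
          le_mul_of_one_le_right (Nat.cast_nonneg _) h₁
      _ ≤ #(A' + A') * ((N : ℝ) ^ (7 * δ) * L ^ (5 - 7 * θ) * u ^ 56) := by gcongr
      _ = (N : ℝ) ^ (7 * δ) * L ^ (5 - 7 * θ) * (#(A' + A') * u ^ 56) := by ring
      _ ≤ (N : ℝ) ^ (7 * δ) * L ^ (5 - 7 * θ) * (2 ^ 63 * #A') := by gcongr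
      _ = 2 ^ 63 * (N : ℝ) ^ (7 * δ) * L ^ (5 - 7 * θ) * #A' := by ring
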